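/- Let 𝒪 ⊂ ℝ^{m−k} × ℝ^n be open and let φ : 𝒪 → ℝᵏ be continuously (Fréchet) differentiable in the Euclidean sense, i.e. φ ∈ C¹(𝒪, ℝᵏ). Then φ is uniformly intrinsically differentiable at every point of 𝒪. -/

import Mathlib

noncomputable section

open Set Filter Topology MeasureTheory

namespace Carnot

/-- Euclidean norm on `Fin d → ℝ`. -/
def enorm {d : ℕ} (x : Fin d → ℝ) : ℝ := Real.sqrt (∑ i, (x i) ^ 2)

/-- The underlying set of the Carnot group `G = ℝ^m × ℝ^n` of class `𝓑`. -/
abbrev G (m n : ℕ) := (Fin m → ℝ) × (Fin n → ℝ)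

/-- Points of the normal complement `W`, identified with `ℝ^(m-k) × ℝ^n`. -/
abbrev W (m n k : ℕ) := (Fin (m - k) → ℝ) × (Fin n → ℝ)

/-- The group law of the Carnot group of class `𝓑` associated with the
skew-symmetric matrices `b s`:
`(x,y)·(x',y') = (x + x', y + y' + ½⟨Bx,x'⟩)`. -/
def gmul {m n : ℕ} (b : Fin n → Matrix (Fin m) (Fin m) ℝ) (P Q : G m n) : G m n :=
  (P.1 + Q.1, fun s => P.2 s + Q.2 s + (1 / 2) * ∑ i, ∑ j, b s i j * P.1 j * Q.1 i)

/-- The group inverse `(x,y)⁻¹ = (-x,-y)`. -/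
def ginv {m n : ℕ} (P : G m n) : G m n := (-P.1, -P.2)

/-- The homogeneous quasi-norm `N(x,y) = |x| + |y|^(1/2)`. -/
def qnorm {m n : ℕ} (P : G m n) : ℝ := enorm P.1 + Real.sqrt (enorm P.2)

/-- Open ball for the quasi-norm: `U(P,r) = {Q : N(P⁻¹·Q) < r}`. -/
def ball (m n : ℕ) (b : Fin n → Matrix (Fin m) (Fin m) ℝ) (P : G m n) (r : ℝ) : Set (G m n) :=
  {Q | qnorm (gmul b (ginv P) Q) < r}

/-- The embedding `i : ℝ^(m-k) × ℝ^n → G`, `i(a,α) = (0,…,0,a,α)`. -/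
def embW (m n k : ℕ) (A : W m n k) : G m n :=
  (fun j => if h : (j : ℕ) < k then 0 else A.1 ⟨(j : ℕ) - k, by have := j.isLt; omega⟩, A.2)

/-- The embedding of `ℝ^k` as the horizontal subgroup `H`, `v ↦ (v,0,…,0)`. -/
def embH (m n k : ℕ) (v : Fin k → ℝ) : G m n :=
  (fun j => if h : (j : ℕ) < k then v ⟨(j : ℕ), h⟩ else 0, 0)

/-- The graph map `Φ(A) = i(A)·φ̂(A)`. -/
def graphMap (m n k : ℕ) (b : Fin n → Matrix (Fin m) (Fin m) ℝ)
    (φ : W m n k → Fin k → ℝ) (A : W m n k) : G m n :=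
  gmul b (embW m n k A) (embH m n k (φ A))

/-- `N(i(A)⁻¹·i(B))`. -/
def dW (m n k : ℕ) (b : Fin n → Matrix (Fin m) (Fin m) ℝ) (A B : W m n k) : ℝ :=
  qnorm (gmul b (ginv (embW m n k A)) (embW m n k B))

/-- The graph quasi-distance `σ_φ(A,B) = N(φ̂(A)⁻¹·i(A)⁻¹·i(B)·φ̂(A))`. -/
def sigma (m n k : ℕ) (b : Fin n → Matrix (Fin m) (Fin m) ℝ)
    (φ : W m n k → Fin k → ℝ) (A B : W m n k) : ℝ :=
  qnorm (gmul b (gmul b (gmul b (ginv (embH m n k (φ A))) (ginv (embW m n k A)))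
    (embW m n k B)) (embH m n k (φ A)))

/-- The matrix `M` satisfies the uniform intrinsic differentiability condition of `φ`
at `A₀ ∈ 𝒪`. -/
def UID (m n k : ℕ) (b : Fin n → Matrix (Fin m) (Fin m) ℝ) (O : Set (W m n k))
    (φ : W m n k → Fin k → ℝ) (A₀ : W m n k) (M : Matrix (Fin k) (Fin (m - k)) ℝ) : Prop :=
  ∀ ε > 0, ∃ r > 0, ∀ A ∈ O, ∀ B ∈ O,
    dW m n k b A₀ A < r → dW m n k b A B < r → 0 < dW m n k b A B →
    enorm (fun j => φ B j - φ A j - ∑ i, M j i * (B.1 i - A.1 i)) ≤ ε * sigma m n k b φ A B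

/-- `f : U → ℝ^k` is of class `C¹_G` with (continuous) horizontal Jacobian `gradf`. -/
def C1G (m n k : ℕ) (b : Fin n → Matrix (Fin m) (Fin m) ℝ) (U : Set (G m n))
    (f : G m n → Fin k → ℝ) (gradf : G m n → Matrix (Fin k) (Fin m) ℝ) : Prop :=
  ContinuousOn f U ∧ ContinuousOn gradf U ∧
  ∀ P ∈ U, ∀ ε > 0, ∃ r > 0, ∀ Q ∈ U,
    qnorm (gmul b (ginv P) Q) < r →
    enorm (fun j => f Q j - f P j - ∑ i, gradf P j i * (Q.1 i - P.1 i)) ≤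
      ε * qnorm (gmul b (ginv P) Q)

/-- The square block `M₁(Q) = (X_i f_j(Q))_{j,i=1,…,k}` of the horizontal Jacobian. -/
def M1 (m n k : ℕ) (hk : k ≤ m) (gradf : G m n → Matrix (Fin k) (Fin m) ℝ) (Q : G m n) :
    Matrix (Fin k) (Fin k) ℝ :=
  Matrix.of fun j i => gradf Q j (Fin.castLE hk i)

/-- The block `M₂(Q) = (X_{k+i} f_j(Q))_{j=1,…,k; i=1,…,m-k}` of the horizontal Jacobian. -/
def M2 (m n k : ℕ) (gradf : G m n → Matrix (Fin k) (Fin m) ℝ) (Q : G m n) :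
    Matrix (Fin k) (Fin (m - k)) ℝ :=
  Matrix.of fun j i => gradf Q j ⟨k + (i : ℕ), by have := i.isLt; omega⟩

/-- The `ℝⁿ`-valued bilinear form `(u, v) ↦ ⟨Bu, v⟩`. -/
def bracket {m n : ℕ} (b : Fin n → Matrix (Fin m) (Fin m) ℝ) :
    (Fin m → ℝ) →ₗ[ℝ] (Fin m → ℝ) →ₗ[ℝ] (Fin n → ℝ) :=
  LinearMap.mk₂ ℝ (fun u v s => ∑ i, ∑ j, b s i j * u j * v i)
    (fun u u' v => by
      ext s; simp only [Pi.add_apply, mul_add, add_mul, Finset.sum_add_distrib])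
    (fun c u v => by
      ext s
      simp only [Pi.smul_apply, smul_eq_mul, Finset.mul_sum]
      exact Finset.sum_congr rfl fun i _ => Finset.sum_congr rfl fun j _ => by ring)
    (fun u v v' => by
      ext s; simp only [Pi.add_apply, mul_add, Finset.sum_add_distrib])
    (fun c u v => by
      ext s
      simp only [Pi.smul_apply, smul_eq_mul, Finset.mul_sum]
      exact Finset.sum_congr rfl fun i _ => Finset.sum_congr rfl fun j _ => by ring)

theorem gmul_eq {m n : ℕ} (b : Fin n → Matrix (Fin m) (Fin m) ℝ) (P Q : G m n) :
    gmul b P Q = (P.1 + Q.1, P.2 + Q.2 + (1 / 2 : ℝ) • bracket b P.1 Q.1) := rfl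

theorem bracket_skew {m n : ℕ} {b : Fin n → Matrix (Fin m) (Fin m) ℝ}
    (hskew : ∀ s, (b s).transpose = -(b s)) (u v : Fin m → ℝ) :
    bracket b u v = -bracket b v u := by
  ext s
  have h (i j : Fin m) : b s j i = -b s i j := congrFun (congrFun (hskew s) i) j
  change ∑ i, ∑ j, b s i j * u j * v i = -∑ i, ∑ j, b s i j * v j * u i
  rw [Finset.sum_comm]
  simp only [← Finset.sum_neg_distrib]
  refine Finset.sum_congr rfl fun i _ => Finset.sum_congr rfl fun j _ => ?_
  rw [h i j]; ring

theorem bracket_self {m n : ℕ} {b : Fin n → Matrix (Fin m) (Fin m) ℝ}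
    (hskew : ∀ s, (b s).transpose = -(b s)) (u : Fin m → ℝ) : bracket b u u = 0 :=
  self_eq_neg.mp (bracket_skew hskew u u)

/-- The inclusion of `ℝ^(m-k)` as the last coordinates of `ℝ^m`. -/
def inclW (m k : ℕ) : (Fin (m - k) → ℝ) →ₗ[ℝ] (Fin m → ℝ) where
  toFun a j := if h : (j : ℕ) < k then 0 else a ⟨(j : ℕ) - k, by have := j.isLt; omega⟩
  map_add' a a' := by ext j; by_cases h : (j : ℕ) < k <;> simp [h]
  map_smul' c a := by ext j; by_cases h : (j : ℕ) < k <;> simp [h]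

/-- The inclusion of `ℝ^k` as the first coordinates of `ℝ^m`. -/
def inclH (m k : ℕ) : (Fin k → ℝ) →ₗ[ℝ] (Fin m → ℝ) where
  toFun v j := if h : (j : ℕ) < k then v ⟨(j : ℕ), h⟩ else 0
  map_add' a a' := by ext j; by_cases h : (j : ℕ) < k <;> simp [h]
  map_smul' c a := by ext j; by_cases h : (j : ℕ) < k <;> simp [h]

/-- The projection of `ℝ^m` onto its last `m - k` coordinates. -/
def projW (m k : ℕ) : (Fin m → ℝ) →ₗ[ℝ] (Fin (m - k) → ℝ) where
  toFun x i := x ⟨k + (i : ℕ), by have := i.isLt; omega⟩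
  map_add' _ _ := rfl
  map_smul' _ _ := rfl

theorem projW_inclW (m k : ℕ) (a : Fin (m - k) → ℝ) : projW m k (inclW m k a) = a := by
  ext i
  simp [projW, inclW]

theorem embW_eq (m n k : ℕ) (A : W m n k) : embW m n k A = (inclW m k A.1, A.2) := rfl

theorem embH_eq (m n k : ℕ) (v : Fin k → ℝ) : embH m n k v = (inclH m k v, 0) := rfl

theorem enorm_eq {d : ℕ} (x : Fin d → ℝ) : enorm x = ‖WithLp.toLp 2 x‖ := by
  simp [enorm, EuclideanSpace.norm_eq]

theorem norm_le_enorm {d : ℕ} (x : Fin d → ℝ) : ‖x‖ ≤ enorm x := by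
  rw [enorm_eq]
  exact (pi_norm_le_iff_of_nonneg (norm_nonneg _)).2 fun i =>
    PiLp.norm_apply_le (WithLp.toLp 2 x) i

theorem enorm_le_sqrt_mul_norm {d : ℕ} (x : Fin d → ℝ) : enorm x ≤ Real.sqrt d * ‖x‖ := by
  rw [← Real.sqrt_sq (norm_nonneg x), ← Real.sqrt_mul (Nat.cast_nonneg d)]
  refine Real.sqrt_le_sqrt ?_
  calc ∑ i, x i ^ 2 ≤ ∑ _i : Fin d, ‖x‖ ^ 2 := by
        refine Finset.sum_le_sum fun i _ => sq_le_sq.2 ?_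
        rw [abs_norm]
        exact norm_le_pi_norm x i
    _ = d * ‖x‖ ^ 2 := by simp

theorem norm_fst_add_sqrt_le_qnorm {m n : ℕ} (P : G m n) :
    ‖P.1‖ + Real.sqrt ‖P.2‖ ≤ qnorm P :=
  add_le_add (norm_le_enorm _) (Real.sqrt_le_sqrt (norm_le_enorm _))

theorem norm_lt_of_qnorm_lt {m n : ℕ} {P : G m n} {δ : ℝ} (hδ : δ ≤ 1)
    (h : qnorm P < δ) : ‖P‖ < δ := by
  have h₁ := (norm_fst_add_sqrt_le_qnorm P).trans_lt h
  have h₂ := Real.sqrt_nonneg ‖P.2‖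
  have h₃ := norm_nonneg P.1
  have h₄ := Real.sq_sqrt (norm_nonneg P.2)
  refine max_lt (by linarith) ?_
  nlinarith

/-- The `W`-coordinates of the product `i(A)·P`. -/
def translate (m n k : ℕ) (b : Fin n → Matrix (Fin m) (Fin m) ℝ) (A : W m n k) (P : G m n) :
    W m n k :=
  (A.1 + projW m k P.1, A.2 + P.2 + (1 / 2 : ℝ) • bracket b (inclW m k A.1) P.1)

theorem continuous_bracket {m n : ℕ} (b : Fin n → Matrix (Fin m) (Fin m) ℝ) :
    Continuous fun p : (Fin m → ℝ) × (Fin m → ℝ) => bracket b p.1 p.2 := by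
  refine continuous_pi fun s => ?_
  change Continuous fun p : (Fin m → ℝ) × (Fin m → ℝ) => ∑ i, ∑ j, b s i j * p.1 j * p.2 i
  fun_prop

theorem continuous_translate (m n k : ℕ) (b : Fin n → Matrix (Fin m) (Fin m) ℝ) :
    Continuous fun q : W m n k × G m n => translate m n k b q.1 q.2 := by
  have hp : Continuous (projW m k) := LinearMap.continuous_of_finiteDimensional _
  have hi : Continuous (inclW m k) := LinearMap.continuous_of_finiteDimensional _
  have hb : Continuous fun q : W m n k × G m n => bracket b (inclW m k q.1.1) q.2.1 :=
    (continuous_bracket b).comp (f := fun q : W m n k × G m n => (inclW m k q.1.1, q.2.1))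
      (by fun_prop)
  unfold translate
  fun_prop

theorem translate_zero (m n k : ℕ) (b : Fin n → Matrix (Fin m) (Fin m) ℝ) (A : W m n k) :
    translate m n k b A 0 = A := by
  simp [translate]

theorem translate_ginv_gmul {m n : ℕ} (k : ℕ) {b : Fin n → Matrix (Fin m) (Fin m) ℝ}
    (hskew : ∀ s, (b s).transpose = -(b s)) (A B : W m n k) :
    translate m n k b A (gmul b (ginv (embW m n k A)) (embW m n k B)) = B := by
  refine Prod.ext ?_ ?_
  · simp [translate, gmul_eq, embW_eq, ginv, projW_inclW]
  · simp [translate, gmul_eq, embW_eq, ginv, bracket_self hskew]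
    abel

theorem exists_dW_lt_of_eventually {m n k : ℕ} {b : Fin n → Matrix (Fin m) (Fin m) ℝ}
    (hskew : ∀ s, (b s).transpose = -(b s)) {A₀ : W m n k} {p : W m n k × W m n k → Prop}
    (hp : ∀ᶠ q in 𝓝 (A₀, A₀), p q) :
    ∃ r > 0, ∀ A B, dW m n k b A₀ A < r → dW m n k b A B < r → p (A, B) := by
  let F : G m n × G m n → W m n k × W m n k := fun P =>
    (translate m n k b A₀ P.1, translate m n k b (translate m n k b A₀ P.1) P.2)
  have ht := continuous_translate m n k b
  have h₁ : Continuous fun P : G m n × G m n => translate m n k b A₀ P.1 :=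
    ht.comp (f := fun P : G m n × G m n => (A₀, P.1)) (by fun_prop)
  have hF : Continuous F := h₁.prodMk
    (ht.comp (f := fun P : G m n × G m n => (translate m n k b A₀ P.1, P.2)) (by fun_prop))
  have hF0 : F 0 = (A₀, A₀) := by simp [F, translate_zero]
  have hev : ∀ᶠ P in 𝓝 (0 : G m n × G m n), p (F P) :=
    hF.continuousAt.eventually (by rwa [hF0])
  obtain ⟨δ, hδ, hball⟩ := Metric.eventually_nhds_iff.1 hev
  refine ⟨min δ 1, lt_min hδ one_pos, fun A B hA hB => ?_⟩
  have hA' := norm_lt_of_qnorm_lt (min_le_right _ _) hA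
  have hB' := norm_lt_of_qnorm_lt (min_le_right _ _) hB
  have := hball (y := (gmul b (ginv (embW m n k A₀)) (embW m n k A),
    gmul b (ginv (embW m n k A)) (embW m n k B)))
    (by rw [dist_zero_right]
        exact max_lt (hA'.trans_le (min_le_left _ _)) (hB'.trans_le (min_le_left _ _)))
  simpa only [F, translate_ginv_gmul k hskew] using this

/-- A strictly differentiable map on a product is approximated by the linear map
`D ∘ (id, T A₀)` in the first variable, up to the anisotropic distance measuring the second
variable by the square root of its deviation from the graph of `T A`. -/
theorem _root_.HasStrictFDerivAt.eventually_norm_sub_le_add_sqrt {V Y Z : Type*}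
    [NormedAddCommGroup V] [NormedSpace ℝ V] [NormedAddCommGroup Y] [NormedSpace ℝ Y]
    [NormedAddCommGroup Z] [NormedSpace ℝ Z] {f : V × Y → Z} {D : V × Y →L[ℝ] Z} {A₀ : V × Y}
    (hf : HasStrictFDerivAt f D A₀) {T : V × Y → V →L[ℝ] Y} (hT : ContinuousAt T A₀)
    {ε : ℝ} (hε : 0 < ε) :
    ∀ᶠ q in 𝓝 (A₀, A₀),
      ‖f q.2 - f q.1 - D (q.2.1 - q.1.1, T A₀ (q.2.1 - q.1.1))‖ ≤
        ε * (‖q.2.1 - q.1.1‖ +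
          Real.sqrt ‖q.2.2 - q.1.2 - T q.1 (q.2.1 - q.1.1)‖) := by
  set C := 2 + ‖T A₀‖ + ‖D‖ with hC
  have hCpos : 0 < C := by positivity
  set η := min 1 (ε / C)
  have hηpos : 0 < η := lt_min one_pos (by positivity)
  have hη1 : η ≤ 1 := min_le_left _ _
  have hηC : η * C ≤ ε := (le_div_iff₀ hCpos).1 (min_le_right _ _)
  have hfst : Tendsto (fun q : (V × Y) × (V × Y) => q.1) (𝓝 (A₀, A₀)) (𝓝 A₀) :=
    continuous_fst.tendsto' _ _ rfl
  have hT' : Tendsto (fun q : (V × Y) × (V × Y) => T q.1) (𝓝 (A₀, A₀)) (𝓝 (T A₀)) :=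
    hT.tendsto.comp hfst
  have hv : Tendsto (fun q : (V × Y) × (V × Y) => q.2.1 - q.1.1) (𝓝 (A₀, A₀)) (𝓝 0) :=
    Continuous.tendsto' (by fun_prop) _ _ (by simp)
  have hy : Tendsto (fun q : (V × Y) × (V × Y) => q.2.2 - q.1.2) (𝓝 (A₀, A₀)) (𝓝 0) :=
    Continuous.tendsto' (by fun_prop) _ _ (by simp)
  have hS : Tendsto (fun q : (V × Y) × (V × Y) =>
      Real.sqrt ‖q.2.2 - q.1.2 - T q.1 (q.2.1 - q.1.1)‖) (𝓝 (A₀, A₀)) (𝓝 0) := by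
    simpa using ((hy.sub (((isBoundedBilinearMap_apply (𝕜 := ℝ) (E := V) (F := Y)).continuous.tendsto
      (T A₀, 0)).comp (hT'.prodMk_nhds hv))).norm).sqrt
  have hTη := Metric.tendsto_nhds.1 hT' η hηpos
  have hSη := hS.eventually (gt_mem_nhds hηpos)
  filter_upwards [hf.isLittleO.def hηpos, hTη, hSη] with q hq hTq hSq
  obtain ⟨A, B⟩ := q
  simp only [dist_eq_norm] at hq hTq hSq ⊢
  set v := B.1 - A.1
  set S := B.2 - A.2 - T A v with hSdef
  have hss := Real.mul_self_sqrt (norm_nonneg S)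
  have hs0 := Real.sqrt_nonneg ‖S‖
  set s := Real.sqrt ‖S‖
  have hBA : B - A = (v, S + T A v) := by
    refine Prod.ext rfl ?_
    simp [hSdef]
  have hSs : ‖S‖ ≤ η * s := by nlinarith
  have hTA : ‖T A‖ ≤ ‖T A₀‖ + 1 := by
    have := norm_sub_norm_le (T A) (T A₀)
    linarith
  have hTv : ‖T A v‖ ≤ (‖T A₀‖ + 1) * ‖v‖ :=
    (T A).le_of_opNorm_le hTA v
  have hnBA : ‖B - A‖ ≤ (2 + ‖T A₀‖) * (‖v‖ + s) := by
    have h₁ : ‖S + T A v‖ ≤ ‖S‖ + ‖T A v‖ := norm_add_le _ _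
    have h₂ : 0 ≤ ‖T A₀‖ * s := by positivity
    have h₃ : 0 ≤ ‖T A₀‖ * ‖v‖ := by positivity
    have h₄ := norm_nonneg v
    have h₅ : η * s ≤ s := mul_le_of_le_one_left hs0 hη1
    rw [hBA]
    refine max_le ?_ ?_ <;> dsimp only <;> nlinarith
  have hsplit : f B - f A - D (v, T A₀ v) =
      (f B - f A - D (B - A)) + D (0, S + (T A - T A₀) v) := by
    have : (B - A) = (v, T A₀ v) + (0, S + (T A - T A₀) v) := by
      rw [hBA]; refine Prod.ext ?_ ?_ <;> simp; abel
    rw [this, map_add]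
    abel
  have hq' : ‖f B - f A - D (B - A)‖ ≤ η * ‖B - A‖ := by
    have : f B - f A - D (B - A) = -(f A - f B - D (A - B)) := by
      rw [← neg_sub A B, map_neg]
      abel
    rwa [this, norm_neg, norm_sub_rev B A]
  have hrest : ‖D (0, S + (T A - T A₀) v)‖ ≤ ‖D‖ * (η * (‖v‖ + s)) := by
    refine D.le_opNorm_of_le ?_
    have h₁ : ‖(T A - T A₀) v‖ ≤ η * ‖v‖ := (T A - T A₀).le_of_opNorm_le hTq.le v
    have h₂ : ‖S + (T A - T A₀) v‖ ≤ η * (‖v‖ + s) :=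
      (norm_add_le _ _).trans (by linarith)
    exact max_le (by rw [norm_zero]; positivity) h₂
  calc ‖f B - f A - D (v, T A₀ v)‖
      ≤ η * ‖B - A‖ + ‖D‖ * (η * (‖v‖ + s)) := by
        rw [hsplit]; exact (norm_add_le _ _).trans (add_le_add hq' hrest)
    _ ≤ η * ((2 + ‖T A₀‖) * (‖v‖ + s)) + ‖D‖ * (η * (‖v‖ + s)) := by gcongr
    _ = η * C * (‖v‖ + s) := by rw [hC]; ring
    _ ≤ ε * (‖v‖ + s) := by gcongr

/-- The linear map `w ↦ ⟨B(½x + h), w⟩` on `ℝ^(m-k)`, where `x` and `h` are the horizontal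
parts of `i(A)` and `φ̂(A)`: it gives the vertical increment along horizontal directions. -/
def horizontalSlope (m n k : ℕ) (b : Fin n → Matrix (Fin m) (Fin m) ℝ)
    (φ : W m n k → Fin k → ℝ) (A : W m n k) : (Fin (m - k) → ℝ) →L[ℝ] (Fin n → ℝ) :=
  ((bracket b).compl₂ (inclW m k)).toContinuousBilinearMap
    ((1 / 2 : ℝ) • inclW m k A.1 + inclH m k (φ A))

theorem horizontalSlope_apply {m n k : ℕ} (b : Fin n → Matrix (Fin m) (Fin m) ℝ)
    (φ : W m n k → Fin k → ℝ) (A : W m n k) (w : Fin (m - k) → ℝ) :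
    horizontalSlope m n k b φ A w =
      bracket b ((1 / 2 : ℝ) • inclW m k A.1 + inclH m k (φ A)) (inclW m k w) := rfl

theorem continuousAt_horizontalSlope {m n k : ℕ} (b : Fin n → Matrix (Fin m) (Fin m) ℝ)
    {φ : W m n k → Fin k → ℝ} {A : W m n k} (hφ : ContinuousAt φ A) :
    ContinuousAt (horizontalSlope m n k b φ) A := by
  have hi : Continuous (inclW m k) := LinearMap.continuous_of_finiteDimensional _
  have hh : Continuous (inclH m k) := LinearMap.continuous_of_finiteDimensional _
  have : ContinuousAt (fun A : W m n k =>
      (1 / 2 : ℝ) • inclW m k A.1 + inclH m k (φ A)) A :=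
    (by fun_prop : Continuous fun A : W m n k => (1 / 2 : ℝ) • inclW m k A.1).continuousAt.add
      (hh.continuousAt.comp hφ)
  exact (ContinuousLinearMap.continuous _).continuousAt.comp this

theorem norm_inclW {m k : ℕ} (w : Fin (m - k) → ℝ) : ‖w‖ ≤ ‖inclW m k w‖ := by
  refine (pi_norm_le_iff_of_nonneg (norm_nonneg _)).2 fun i => ?_
  conv_lhs => rw [← projW_inclW m k w]
  exact norm_le_pi_norm (inclW m k w) _

theorem norm_add_sqrt_le_sigma {m n k : ℕ} {b : Fin n → Matrix (Fin m) (Fin m) ℝ}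
    (hskew : ∀ s, (b s).transpose = -(b s)) (φ : W m n k → Fin k → ℝ) (A B : W m n k) :
    ‖B.1 - A.1‖ + Real.sqrt ‖B.2 - A.2 - horizontalSlope m n k b φ A (B.1 - A.1)‖ ≤
      sigma m n k b φ A B := by
  refine le_trans ?_ (norm_fst_add_sqrt_le_qnorm _)
  have h := bracket_self hskew (inclH m k (φ A))
  have hx := bracket_self hskew (inclW m k A.1)
  have hxh := bracket_skew hskew (inclW m k A.1) (inclH m k (φ A))
  have hyh := bracket_skew hskew (inclW m k B.1) (inclH m k (φ A))
  refine add_le_add ((norm_inclW _).trans_eq ?_) (Real.sqrt_le_sqrt (le_of_eq ?_))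
  · congr 1
    simp only [gmul_eq, ginv, embW_eq, embH_eq, map_sub]
    abel
  · congr 1
    simp only [gmul_eq, ginv, embW_eq, embH_eq, horizontalSlope_apply, map_sub, map_add, map_neg,
      map_smul, LinearMap.add_apply, LinearMap.neg_apply, LinearMap.smul_apply, h, hx, hxh, hyh]
    module

/-- A Euclidean `C¹` map `φ : 𝒪 → ℝ^k` is uniformly intrinsically
differentiable at every point of the open set `𝒪`. -/
theorem statement7 (m n k : ℕ) (hm : 2 ≤ m) (hn : 1 ≤ n) (hk : 1 ≤ k) (hkm : k < m)
    (b : Fin n → Matrix (Fin m) (Fin m) ℝ)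
    (hskew : ∀ s, (b s).transpose = -(b s)) (hind : LinearIndependent ℝ b)
    (hblock : ∀ s (i j : Fin m), (i : ℕ) < k → (j : ℕ) < k → b s i j = 0)
    (O : Set (W m n k)) (hO : IsOpen O) (φ : W m n k → Fin k → ℝ)
    (hφ : ContDiffOn ℝ 1 φ O) :
    ∀ A ∈ O, ∃ M, UID m n k b O φ A M := by
  intro A₀ hA₀
  have hφ₀ : ContDiffAt ℝ 1 φ A₀ := hφ.contDiffAt (hO.mem_nhds hA₀)
  have hstrict := hφ₀.hasStrictFDerivAt one_ne_zero
  set D := fderiv ℝ φ A₀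
  set T := horizontalSlope m n k b φ
  let L : (Fin (m - k) → ℝ) →ₗ[ℝ] (Fin k → ℝ) :=
    (D.comp ((ContinuousLinearMap.id ℝ _).prod (T A₀))).toLinearMap
  refine ⟨LinearMap.toMatrix' L, fun ε hε => ?_⟩
  have hc : 0 < Real.sqrt k := Real.sqrt_pos.2 (by exact_mod_cast hk)
  obtain ⟨r, hr, H⟩ := exists_dW_lt_of_eventually hskew
    (hstrict.eventually_norm_sub_le_add_sqrt
      (continuousAt_horizontalSlope b hφ₀.continuousAt) (div_pos hε hc))
  refine ⟨r, hr, fun A _ B _ hA hB _ => ?_⟩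
  have hL : (fun j => φ B j - φ A j - ∑ i, LinearMap.toMatrix' L j i * (B.1 i - A.1 i)) =
      φ B - φ A - D (B.1 - A.1, T A₀ (B.1 - A.1)) := by
    ext j
    have := congrFun (LinearMap.toMatrix'_mulVec L (B.1 - A.1)) j
    exact congrArg (φ B j - φ A j - ·) this
  rw [hL]
  calc _ ≤ Real.sqrt k * ‖φ B - φ A - D (B.1 - A.1, T A₀ (B.1 - A.1))‖ :=
        enorm_le_sqrt_mul_norm _
    _ ≤ Real.sqrt k * (ε / Real.sqrt k * sigma m n k b φ A B) := by
        gcongr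
        refine (H A B hA hB).trans ?_
        gcongr
        exact norm_add_sqrt_le_sigma hskew φ A B
    _ = ε * sigma m n k b φ A B := by field_simp

end Carnot
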